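/- arXiv:2108.07637 — 2 statements merged into one kernel-verified Lean document; each statement's English description precedes it below -/
import Mathlib

section
/- For every n ≥ 1, the lattice ASM_n of n×n alternating sign matrices under the partial-sum order is a distributive lattice: for all A, B, D ∈ ASM_n one has A ∧ (B ∨ D) = (A ∧ B) ∨ (A ∧ D). -/
namespace ASMPaper

/-- The nonzero entries of a vector (a row or a column of a matrix) alternate in sign:
any two nonzero entries with only zero entries strictly between them have opposite values. -/
def Alternating {n : ℕ} (v : Fin n → ℤ) : Prop :=
  ∀ j₁ j₂ : Fin n, j₁ < j₂ → v j₁ ≠ 0 → v j₂ ≠ 0 →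
    (∀ j, j₁ < j → j < j₂ → v j = 0) → v j₂ = - v j₁

/-- `A` is an alternating sign matrix: entries in `{-1,0,1}`, all row and column sums
equal to `1`, and the nonzero entries in each row and column alternate in sign. -/
def IsASM {n : ℕ} (A : Matrix (Fin n) (Fin n) ℤ) : Prop :=
  (∀ i j, A i j = -1 ∨ A i j = 0 ∨ A i j = 1) ∧
  (∀ i, ∑ j, A i j = 1) ∧
  (∀ j, ∑ i, A i j = 1) ∧
  (∀ i, Alternating (fun j => A i j)) ∧
  (∀ j, Alternating (fun i => A i j))

/-- The partial sum `C(A)_{kl} = ∑_{i ≤ k, j ≤ l} A_{ij}`. -/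
def Csum {n : ℕ} (A : Matrix (Fin n) (Fin n) ℤ) (k l : Fin n) : ℤ :=
  ∑ i ∈ Finset.Iic k, ∑ j ∈ Finset.Iic l, A i j

/-- The partial-sum (Bruhat) order on alternating sign matrices:
`A ≤ B` iff all partial sums of `A` are at least those of `B`. -/
def asmLe {n : ℕ} (A B : Matrix (Fin n) (Fin n) ℤ) : Prop :=
  ∀ k l, Csum B k l ≤ Csum A k l

end ASMPaper

namespace ASMPaper

/-- `J` is the least upper bound (join) of the alternating sign matrices `A` and `B`
in the partial-sum order on `ASM_n`. -/
def IsJoin {n : ℕ} (A B J : Matrix (Fin n) (Fin n) ℤ) : Prop :=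
  IsASM J ∧ asmLe A J ∧ asmLe B J ∧
    ∀ D : Matrix (Fin n) (Fin n) ℤ, IsASM D → asmLe A D → asmLe B D → asmLe J D

/-- `M` is the greatest lower bound (meet) of the alternating sign matrices `A` and `B`
in the partial-sum order on `ASM_n`. -/
def IsMeet {n : ℕ} (A B M : Matrix (Fin n) (Fin n) ℤ) : Prop :=
  IsASM M ∧ asmLe M A ∧ asmLe M B ∧
    ∀ D : Matrix (Fin n) (Fin n) ℤ, IsASM D → asmLe D A → asmLe D B → asmLe D M

end ASMPaper

namespace ASMPaper

/-- The sum of the first `l` entries of a vector. -/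
def prefixSum {n : ℕ} (v : Fin n → ℤ) (l : ℕ) : ℤ :=
  ∑ j : Fin n with j.val < l, v j

theorem prefixSum_zero {n : ℕ} (v : Fin n → ℤ) : prefixSum v 0 = 0 := by
  simp [prefixSum]

theorem prefixSum_self {n : ℕ} (v : Fin n → ℤ) : prefixSum v n = ∑ j, v j := by
  simp [prefixSum]

theorem prefixSum_succ {n : ℕ} (v : Fin n → ℤ) (j : Fin n) :
    prefixSum v (j + 1) = prefixSum v j + v j := by
  have h : (Finset.univ.filter fun i : Fin n => i.val < j + 1) =
      insert j (Finset.univ.filter fun i : Fin n => i.val < j) := by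
    ext i
    simp only [Finset.mem_filter, Finset.mem_univ, true_and, Finset.mem_insert, Fin.ext_iff]
    omega
  rw [prefixSum, h, Finset.sum_insert (by simp), add_comm, prefixSum]

theorem prefixSum_eq_sub {n : ℕ} {v : Fin n → ℤ} {g : ℕ → ℤ}
    (h : ∀ j : Fin n, v j = g (j + 1) - g j) {l : ℕ} (hl : l ≤ n) :
    prefixSum v l = g l - g 0 := by
  induction l with
  | zero => simp [prefixSum_zero]
  | succ l ih =>
    have h₁ := prefixSum_succ v ⟨l, hl⟩
    have h₂ := h ⟨l, hl⟩
    have h₃ := ih (by omega)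
    simp only at h₁ h₂
    omega

theorem prefixSum_eq_of_zero {n : ℕ} {v : Fin n → ℤ} {a b : ℕ} (hab : a ≤ b) (hb : b ≤ n)
    (h : ∀ j : Fin n, a ≤ j → j < b → v j = 0) : prefixSum v b = prefixSum v a := by
  induction b, hab using Nat.le_induction with
  | base => rfl
  | succ b hab ih =>
    have h₁ := prefixSum_succ v ⟨b, hb⟩
    have h₂ := h ⟨b, hb⟩ hab (by simp)
    have h₃ := ih (by omega) fun j h₁ h₂ => h j h₁ (by omega)
    simp only at h₁
    omega

/-- Up to any position, either no nonzero entry has occurred, or all prefix sums lie in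
`{0, f}`, where `f` is the first nonzero entry. -/
theorem Alternating.prefixSum_invariant {n : ℕ} {v : Fin n → ℤ} (hv : Alternating v)
    (he : ∀ j, v j = -1 ∨ v j = 0 ∨ v j = 1) {l : ℕ} (hl : l ≤ n) :
    (∀ j : Fin n, j.val < l → v j = 0) ∨
      ∃ f : ℤ, (f = 1 ∨ f = -1) ∧ (∀ m ≤ l, prefixSum v m = 0 ∨ prefixSum v m = f) ∧
        ∃ j₀ : Fin n, j₀.val < l ∧ v j₀ ≠ 0 ∧
          (∀ j : Fin n, j₀ < j → j.val < l → v j = 0) ∧ 2 * prefixSum v l = f + v j₀ := by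
  induction l with
  | zero => left; intro j hj; omega
  | succ l ih =>
    have hs : prefixSum v (l + 1) = prefixSum v l + v ⟨l, hl⟩ := prefixSum_succ v ⟨l, hl⟩
    have hlast : ∀ j : Fin n, j.val < l + 1 → j.val < l ∨ j = ⟨l, hl⟩ := by
      intro j hj
      rw [Fin.ext_iff]
      simp only
      omega
    rcases ih (by omega) with hz | ⟨f, hf, hm, j₀, hj₀, hne, hbetween, hsum⟩
    · have hzero : ∀ m ≤ l, prefixSum v m = 0 := fun m hml => by
        rw [prefixSum_eq_of_zero (Nat.zero_le m) (by omega)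
          fun j _ hj => hz j (by omega), prefixSum_zero]
      have hl0 := hzero l le_rfl
      by_cases h0 : v ⟨l, hl⟩ = 0
      · left
        intro j hj
        rcases hlast j hj with h | rfl
        · exact hz j h
        · exact h0
      · right
        refine ⟨v ⟨l, hl⟩, ?_, fun m hml => ?_, ⟨l, hl⟩, by simp, h0, fun j hj hj' => ?_, ?_⟩
        · have := he ⟨l, hl⟩
          omega
        · rcases Nat.lt_or_ge l m with h | h
          · obtain rfl : m = l + 1 := by omega
            right; omega
          · exact Or.inl (hzero m h)
        · rw [Fin.lt_def] at hj
          simp only at hj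
          omega
        · omega
    · right
      by_cases h0 : v ⟨l, hl⟩ = 0
      · rw [h0, add_zero] at hs
        refine ⟨f, hf, fun m hml => ?_, j₀, by omega, hne, fun j hj hj' => ?_, by rw [hs, hsum]⟩
        · rcases Nat.lt_or_ge l m with h | h
          · obtain rfl : m = l + 1 := by omega
            rw [hs]; exact hm l le_rfl
          · exact hm m h
        · rcases hlast j hj' with h | rfl
          · exact hbetween j hj h
          · exact h0
      · have halt := hv j₀ ⟨l, hl⟩ (by simpa [Fin.lt_def] using hj₀) hne h0
          fun j h₁ h₂ => hbetween j h₁ (by simpa [Fin.lt_def] using h₂)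
        have he₀ := he j₀
        refine ⟨f, hf, fun m hml => ?_, ⟨l, hl⟩, by simp, h0, fun j hj hj' => ?_, by omega⟩
        · rcases Nat.lt_or_ge l m with h | h
          · obtain rfl : m = l + 1 := by omega
            omega
          · exact hm m h
        · rw [Fin.lt_def] at hj
          simp only at hj
          omega

theorem Alternating.prefixSum_mem {n : ℕ} {v : Fin n → ℤ} (hv : Alternating v)
    (he : ∀ j, v j = -1 ∨ v j = 0 ∨ v j = 1) (hsum : ∑ j, v j = 1) {l : ℕ} (hl : l ≤ n) :
    prefixSum v l = 0 ∨ prefixSum v l = 1 := by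
  rcases hv.prefixSum_invariant he le_rfl with hz | ⟨f, hf, hm, -⟩
  · rw [Finset.sum_eq_zero fun j _ => hz j j.isLt] at hsum
    omega
  · have h₁ := hm n le_rfl
    have h₂ := hm l hl
    rw [prefixSum_self, hsum] at h₁
    omega

theorem entry_mem_of_prefixSum_mem {n : ℕ} {v : Fin n → ℤ}
    (h : ∀ l ≤ n, prefixSum v l = 0 ∨ prefixSum v l = 1) (j : Fin n) :
    v j = -1 ∨ v j = 0 ∨ v j = 1 := by
  have h₁ := prefixSum_succ v j
  have h₂ := h j (by omega)
  have h₃ := h (j + 1) (by omega)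
  omega

theorem alternating_of_prefixSum_mem {n : ℕ} {v : Fin n → ℤ}
    (h : ∀ l ≤ n, prefixSum v l = 0 ∨ prefixSum v l = 1) : Alternating v := by
  intro j₁ j₂ hlt h₁ h₂ hz
  have s₁ := prefixSum_succ v j₁
  have s₂ := prefixSum_succ v j₂
  have s₃ : prefixSum v j₂ = prefixSum v (j₁ + 1) :=
    prefixSum_eq_of_zero (by omega) (by omega) fun j h₁ h₂ => hz j (by omega) (by omega)
  have m₁ := h j₁ (by omega)
  have m₂ := h (j₁ + 1) (by omega)
  have m₃ := h (j₂ + 1) (by omega)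
  omega

/-- The sum of the entries in the upper left `k × l` corner of a matrix. -/
def cornerSum {n : ℕ} (A : Matrix (Fin n) (Fin n) ℤ) (k l : ℕ) : ℤ :=
  prefixSum (fun i => prefixSum (fun j => A i j) l) k

theorem cornerSum_comm {n : ℕ} (A : Matrix (Fin n) (Fin n) ℤ) (k l : ℕ) :
    cornerSum A k l = prefixSum (fun j => prefixSum (fun i => A i j) k) l := by
  simp only [cornerSum, prefixSum]
  exact Finset.sum_comm

theorem Csum_eq_cornerSum {n : ℕ} (A : Matrix (Fin n) (Fin n) ℤ) (k l : Fin n) :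
    Csum A k l = cornerSum A (k + 1) (l + 1) := by
  have h : ∀ k : Fin n, Finset.Iic k = Finset.univ.filter fun i : Fin n => i.val < k + 1 := by
    intro k
    ext i
    simp only [Finset.mem_Iic, Finset.mem_filter, Finset.mem_univ, true_and, Fin.le_def]
    omega
  simp only [Csum, cornerSum, prefixSum, h]

theorem cornerSum_zero_left {n : ℕ} (A : Matrix (Fin n) (Fin n) ℤ) (l : ℕ) :
    cornerSum A 0 l = 0 := prefixSum_zero _

theorem cornerSum_zero_right {n : ℕ} (A : Matrix (Fin n) (Fin n) ℤ) (k : ℕ) :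
    cornerSum A k 0 = 0 := by
  rw [cornerSum_comm, prefixSum_zero]

theorem cornerSum_succ_left {n : ℕ} (A : Matrix (Fin n) (Fin n) ℤ) (i : Fin n) (l : ℕ) :
    cornerSum A (i + 1) l = cornerSum A i l + prefixSum (fun j => A i j) l :=
  prefixSum_succ _ i

theorem cornerSum_succ_right {n : ℕ} (A : Matrix (Fin n) (Fin n) ℤ) (k : ℕ) (j : Fin n) :
    cornerSum A k (j + 1) = cornerSum A k j + prefixSum (fun i => A i j) k := by
  simp only [cornerSum_comm]
  exact prefixSum_succ _ j

theorem eq_of_Csum_eq {n : ℕ} {A B : Matrix (Fin n) (Fin n) ℤ}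
    (h : ∀ k l, Csum A k l = Csum B k l) : A = B := by
  have hc : ∀ k ≤ n, ∀ l ≤ n, cornerSum A k l = cornerSum B k l := by
    intro k hk l hl
    rcases k with - | k
    · simp only [cornerSum_zero_left]
    rcases l with - | l
    · simp only [cornerSum_zero_right]
    simpa only [Csum_eq_cornerSum] using h ⟨k, hk⟩ ⟨l, hl⟩
  ext i j
  have hrow : ∀ l ≤ n, prefixSum (fun j => A i j) l = prefixSum (fun j => B i j) l := by
    intro l hl
    have h₁ := cornerSum_succ_left A i l
    have h₂ := cornerSum_succ_left B i l
    have h₃ := hc i (by omega) l hl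
    have h₄ := hc (i + 1) (by omega) l hl
    omega
  have h₁ : _ = _ + A i j := prefixSum_succ (fun j => A i j) j
  have h₂ : _ = _ + B i j := prefixSum_succ (fun j => B i j) j
  have h₃ := hrow j (by omega)
  have h₄ := hrow (j + 1) (by omega)
  omega

/-- The conditions characterizing the corner sums of `n × n` alternating sign matrices. -/
structure IsCornerSum (n : ℕ) (c : ℕ → ℕ → ℤ) : Prop where
  zero_left : ∀ l ≤ n, c 0 l = 0
  zero_right : ∀ k ≤ n, c k 0 = 0
  last_left : ∀ l ≤ n, c n l = l
  last_right : ∀ k ≤ n, c k n = k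
  succ_left : ∀ k < n, ∀ l ≤ n, c (k + 1) l = c k l ∨ c (k + 1) l = c k l + 1
  succ_right : ∀ k ≤ n, ∀ l < n, c k (l + 1) = c k l ∨ c k (l + 1) = c k l + 1

theorem IsASM.isCornerSum {n : ℕ} {A : Matrix (Fin n) (Fin n) ℤ} (hA : IsASM A) :
    IsCornerSum n (cornerSum A) := by
  obtain ⟨he, hr, hc, har, hac⟩ := hA
  refine ⟨fun l _ => cornerSum_zero_left A l, fun k _ => cornerSum_zero_right A k,
    fun l hl => ?_, fun k hk => ?_, fun k hk l hl => ?_, fun k hk l hl => ?_⟩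
  · rw [cornerSum_comm, prefixSum_eq_sub (g := fun l => (l : ℤ)) _ hl]
    · simp
    · intro j
      rw [prefixSum_self, hc]
      push_cast
      ring
  · rw [cornerSum, prefixSum_eq_sub (g := fun l => (l : ℤ)) _ hk]
    · simp
    · intro i
      rw [prefixSum_self, hr]
      push_cast
      ring
  · have h₁ : cornerSum A (k + 1) l = _ := cornerSum_succ_left A ⟨k, hk⟩ l
    have h₂ := (har ⟨k, hk⟩).prefixSum_mem (he _) (hr _) hl
    simp only at h₁
    omega
  · have h₁ : cornerSum A k (l + 1) = _ := cornerSum_succ_right A k ⟨l, hl⟩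
    have h₂ := (hac ⟨l, hl⟩).prefixSum_mem (fun i => he i _) (hc _) hk
    simp only at h₁
    omega

/-- The matrix with prescribed corner sums. -/
def ofCornerSum (n : ℕ) (c : ℕ → ℕ → ℤ) : Matrix (Fin n) (Fin n) ℤ :=
  fun i j => c (i + 1) (j + 1) - c i (j + 1) - (c (i + 1) j - c i j)

namespace IsCornerSum

variable {n : ℕ} {c d : ℕ → ℕ → ℤ}

theorem prefixSum_row (hc : IsCornerSum n c) (i : Fin n) {l : ℕ} (hl : l ≤ n) :
    prefixSum (fun j => ofCornerSum n c i j) l = c (i + 1) l - c i l := by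
  rw [prefixSum_eq_sub (g := fun l => c (i + 1) l - c i l) (fun _ => by rfl) hl,
    hc.zero_right _ (by omega), hc.zero_right _ (by omega)]
  ring

theorem prefixSum_col (hc : IsCornerSum n c) (j : Fin n) {k : ℕ} (hk : k ≤ n) :
    prefixSum (fun i => ofCornerSum n c i j) k = c k (j + 1) - c k j := by
  rw [prefixSum_eq_sub (g := fun k => c k (j + 1) - c k j) _ hk,
    hc.zero_left _ (by omega), hc.zero_left _ (by omega)]
  · ring
  · intro i
    simp only [ofCornerSum]
    ring

theorem cornerSum_ofCornerSum (hc : IsCornerSum n c) {k l : ℕ} (hk : k ≤ n) (hl : l ≤ n) :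
    cornerSum (ofCornerSum n c) k l = c k l := by
  rw [cornerSum, prefixSum_eq_sub (g := fun k => c k l) (fun i => hc.prefixSum_row i hl) hk,
    hc.zero_left _ hl, sub_zero]

theorem Csum_ofCornerSum (hc : IsCornerSum n c) (k l : Fin n) :
    Csum (ofCornerSum n c) k l = c (k + 1) (l + 1) := by
  rw [Csum_eq_cornerSum, hc.cornerSum_ofCornerSum (by omega) (by omega)]

theorem isASM_ofCornerSum (hc : IsCornerSum n c) : IsASM (ofCornerSum n c) := by
  have hrow : ∀ i : Fin n, ∀ l ≤ n, prefixSum (fun j => ofCornerSum n c i j) l = 0 ∨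
      prefixSum (fun j => ofCornerSum n c i j) l = 1 := by
    intro i l hl
    rw [hc.prefixSum_row i hl]
    have := hc.succ_left i i.isLt l hl
    omega
  have hcol : ∀ j : Fin n, ∀ k ≤ n, prefixSum (fun i => ofCornerSum n c i j) k = 0 ∨
      prefixSum (fun i => ofCornerSum n c i j) k = 1 := by
    intro j k hk
    rw [hc.prefixSum_col j hk]
    have := hc.succ_right k hk j j.isLt
    omega
  refine ⟨fun i j => entry_mem_of_prefixSum_mem (hrow i) j, fun i => ?_, fun j => ?_,
    fun i => alternating_of_prefixSum_mem (hrow i),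
    fun j => alternating_of_prefixSum_mem (hcol j)⟩
  · rw [← prefixSum_self, hc.prefixSum_row i le_rfl, hc.last_right _ (by omega),
      hc.last_right _ (by omega)]
    push_cast
    ring
  · rw [← prefixSum_self, hc.prefixSum_col j le_rfl, hc.last_left _ (by omega),
      hc.last_left _ (by omega)]
    push_cast
    ring

theorem max (hc : IsCornerSum n c) (hd : IsCornerSum n d) :
    IsCornerSum n fun k l => Max.max (c k l) (d k l) where
  zero_left l hl := by simp [hc.zero_left l hl, hd.zero_left l hl]
  zero_right k hk := by simp [hc.zero_right k hk, hd.zero_right k hk]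
  last_left l hl := by simp [hc.last_left l hl, hd.last_left l hl]
  last_right k hk := by simp [hc.last_right k hk, hd.last_right k hk]
  succ_left k hk l hl := by
    have h₁ := hc.succ_left k hk l hl
    have h₂ := hd.succ_left k hk l hl
    omega
  succ_right k hk l hl := by
    have h₁ := hc.succ_right k hk l hl
    have h₂ := hd.succ_right k hk l hl
    omega

theorem min (hc : IsCornerSum n c) (hd : IsCornerSum n d) :
    IsCornerSum n fun k l => Min.min (c k l) (d k l) where
  zero_left l hl := by simp [hc.zero_left l hl, hd.zero_left l hl]
  zero_right k hk := by simp [hc.zero_right k hk, hd.zero_right k hk]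
  last_left l hl := by simp [hc.last_left l hl, hd.last_left l hl]
  last_right k hk := by simp [hc.last_right k hk, hd.last_right k hk]
  succ_left k hk l hl := by
    have h₁ := hc.succ_left k hk l hl
    have h₂ := hd.succ_left k hk l hl
    omega
  succ_right k hk l hl := by
    have h₁ := hc.succ_right k hk l hl
    have h₂ := hd.succ_right k hk l hl
    omega

end IsCornerSum

theorem IsMeet.Csum_eq {n : ℕ} {A B M : Matrix (Fin n) (Fin n) ℤ} (hM : IsMeet A B M)
    (hA : IsASM A) (hB : IsASM B) (k l : Fin n) :
    Csum M k l = max (Csum A k l) (Csum B k l) := by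
  obtain ⟨-, hMA, hMB, hgreatest⟩ := hM
  have hc := hA.isCornerSum.max hB.isCornerSum
  refine le_antisymm ?_ (max_le (hMA k l) (hMB k l))
  have h := hgreatest _ hc.isASM_ofCornerSum
    (fun k l => by
      rw [hc.Csum_ofCornerSum, Csum_eq_cornerSum]; exact le_max_left _ _)
    (fun k l => by
      rw [hc.Csum_ofCornerSum, Csum_eq_cornerSum]; exact le_max_right _ _) k l
  rwa [hc.Csum_ofCornerSum, ← Csum_eq_cornerSum, ← Csum_eq_cornerSum] at h

theorem IsJoin.Csum_eq {n : ℕ} {A B J : Matrix (Fin n) (Fin n) ℤ} (hJ : IsJoin A B J)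
    (hA : IsASM A) (hB : IsASM B) (k l : Fin n) :
    Csum J k l = min (Csum A k l) (Csum B k l) := by
  obtain ⟨-, hAJ, hBJ, hleast⟩ := hJ
  have hc := hA.isCornerSum.min hB.isCornerSum
  refine le_antisymm (le_min (hAJ k l) (hBJ k l)) ?_
  have h := hleast _ hc.isASM_ofCornerSum
    (fun k l => by
      rw [hc.Csum_ofCornerSum, Csum_eq_cornerSum]; exact min_le_left _ _)
    (fun k l => by
      rw [hc.Csum_ofCornerSum, Csum_eq_cornerSum]; exact min_le_right _ _) k l
  rwa [hc.Csum_ofCornerSum, ← Csum_eq_cornerSum, ← Csum_eq_cornerSum] at h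

end ASMPaper

open ASMPaper in
/-- The lattice `ASM_n` is distributive: `A ∧ (B ∨ D) = (A ∧ B) ∨ (A ∧ D)`
for all alternating sign matrices `A`, `B`, `D`. -/
theorem asm_lattice_distributive (n : ℕ) (hn : 1 ≤ n)
    (A B D : Matrix (Fin n) (Fin n) ℤ) (hA : IsASM A) (hB : IsASM B) (hD : IsASM D)
    (JBD MAB MAD L R : Matrix (Fin n) (Fin n) ℤ)
    (hJBD : IsJoin B D JBD) (hMAB : IsMeet A B MAB) (hMAD : IsMeet A D MAD)
    (hL : IsMeet A JBD L) (hR : IsJoin MAB MAD R) :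
    L = R := by
  refine eq_of_Csum_eq fun k l => ?_
  rw [hL.Csum_eq hA hJBD.1, hJBD.Csum_eq hB hD, hR.Csum_eq hMAB.1 hMAD.1, hMAB.Csum_eq hA hB,
    hMAD.Csum_eq hA hD]
  exact max_min_distrib_left _ _ _
end

section
/- For every n ≥ 2, the join-irreducible elements of the lattice ASM_n are exactly the permutation matrices of bigrassmannian permutations: an element A ∈ ASM_n is join-irreducible (i.e., A is not the least upper bound of any set of elements of ASM_n not containing A) if and only if A = [w] for a permutation w of {1,…,n} such that w has exactly one descent and w⁻¹ has exactly one descent. -/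
namespace ASMPaper

/-- The permutation matrix of `x`: `[x]_{ij} = 1` if `x j = i` and `0` otherwise. -/
def permMat {n : ℕ} (x : Equiv.Perm (Fin n)) : Matrix (Fin n) (Fin n) ℤ :=
  Matrix.of fun i j => if x j = i then 1 else 0

/-- The set of descents of a permutation `w` of `Fin n`: 0-indexed positions `i` with
`i + 1 < n` and `w (i+1) < w i`. -/
def descents {n : ℕ} (w : Equiv.Perm (Fin n)) : Finset ℕ :=
  (Finset.range (n - 1)).filter
    (fun i => ∀ h : i + 1 < n, w ⟨i + 1, h⟩ < w ⟨i, Nat.lt_of_succ_lt h⟩)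

/-- A permutation is bigrassmannian if it and its inverse each have exactly one descent. -/
def Bigrassmannian {n : ℕ} (w : Equiv.Perm (Fin n)) : Prop :=
  (descents w).card = 1 ∧ (descents w⁻¹).card = 1

end ASMPaper

namespace ASMPaper

/-! ### Corner sums -/

/-- Entries of a matrix, extended by zero to all pairs of natural numbers. -/
def entry {n : ℕ} (A : Matrix (Fin n) (Fin n) ℤ) (i j : ℕ) : ℤ :=
  if h : i < n ∧ j < n then A ⟨i, h.1⟩ ⟨j, h.2⟩ else 0

/-- The sum of the entries in the first `k` rows and first `l` columns. -/
def corner {n : ℕ} (A : Matrix (Fin n) (Fin n) ℤ) (k l : ℕ) : ℤ :=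
  ∑ i ∈ Finset.range k, ∑ j ∈ Finset.range l, entry A i j

/-- The conditions characterising the corner sum functions of alternating sign matrices. -/
structure IsCorner (n : ℕ) (f : ℕ → ℕ → ℤ) : Prop where
  zero_left : ∀ l ≤ n, f 0 l = 0
  zero_right : ∀ k ≤ n, f k 0 = 0
  top_left : ∀ l ≤ n, f n l = l
  top_right : ∀ k ≤ n, f k n = k
  step_left : ∀ k < n, ∀ l ≤ n, f (k + 1) l = f k l ∨ f (k + 1) l = f k l + 1
  step_right : ∀ k ≤ n, ∀ l < n, f k (l + 1) = f k l ∨ f k (l + 1) = f k l + 1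

/-- The matrix with prescribed corner sums. -/
def ofCorner (n : ℕ) (f : ℕ → ℕ → ℤ) : Matrix (Fin n) (Fin n) ℤ :=
  Matrix.of fun i j => f (i + 1) (j + 1) - f i (j + 1) - f (i + 1) j + f i j

section Corner

variable {n : ℕ} (A : Matrix (Fin n) (Fin n) ℤ)

lemma entry_coe (i j : Fin n) : entry A i j = A i j := by
  simp [entry]

lemma corner_transpose (k l : ℕ) : corner A.transpose k l = corner A l k := by
  unfold corner
  rw [Finset.sum_comm]
  refine Finset.sum_congr rfl fun i _ => Finset.sum_congr rfl fun j _ => ?_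
  simp only [entry, Matrix.transpose_apply, and_comm]

@[simp] lemma corner_zero_left (l : ℕ) : corner A 0 l = 0 := by simp [corner]

@[simp] lemma corner_zero_right (k : ℕ) : corner A k 0 = 0 := by simp [corner]

lemma corner_succ_left (k l : ℕ) :
    corner A (k + 1) l = corner A k l + ∑ j ∈ Finset.range l, entry A k j := by
  simp [corner, Finset.sum_range_succ]

lemma corner_succ_right (k l : ℕ) :
    corner A k (l + 1) = corner A k l + ∑ i ∈ Finset.range k, entry A i l := by
  simp [corner, Finset.sum_range_succ, Finset.sum_add_distrib]

lemma entry_eq_corner (k l : ℕ) :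
    entry A k l = corner A (k + 1) (l + 1) - corner A k (l + 1) - corner A (k + 1) l
      + corner A k l := by
  rw [corner_succ_left, corner_succ_left, Finset.sum_range_succ]
  ring

lemma sum_Iic_eq_sum_range (v : ℕ → ℤ) (k : Fin n) :
    ∑ i ∈ Finset.Iic k, v i = ∑ i ∈ Finset.range (k + 1), v i := by
  refine Finset.sum_bij (fun i _ => (i : ℕ)) ?_ ?_ ?_ ?_
  · intro i hi
    simp only [Finset.mem_Iic, Fin.le_def] at hi
    simp only [Finset.mem_range]
    omega
  · intro i _ j _ h
    exact Fin.ext h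
  · intro i hi
    simp only [Finset.mem_range] at hi
    exact ⟨⟨i, by omega⟩, by simp only [Finset.mem_Iic, Fin.le_def]; omega, rfl⟩
  · intros
    rfl

lemma Csum_eq_corner (k l : Fin n) : Csum A k l = corner A (k + 1) (l + 1) := by
  unfold Csum corner
  rw [← sum_Iic_eq_sum_range (fun i => ∑ j ∈ Finset.range (l + 1), entry A i j) k]
  refine Finset.sum_congr rfl fun i _ => ?_
  rw [← sum_Iic_eq_sum_range (fun j => entry A i j) l]
  simp only [entry_coe]

variable {A}

lemma asmLe_iff_corner {B : Matrix (Fin n) (Fin n) ℤ} :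
    asmLe A B ↔ ∀ k ≤ n, ∀ l ≤ n, corner B k l ≤ corner A k l := by
  constructor
  · intro h k hk l hl
    rcases k with _ | k
    · simp
    rcases l with _ | l
    · simp
    have := h ⟨k, hk⟩ ⟨l, hl⟩
    simpa only [Csum_eq_corner] using this
  · intro h k l
    rw [Csum_eq_corner, Csum_eq_corner]
    exact h _ k.2 _ l.2

lemma eq_of_corner_eq {B : Matrix (Fin n) (Fin n) ℤ}
    (h : ∀ k ≤ n, ∀ l ≤ n, corner A k l = corner B k l) : A = B := by
  ext i j
  rw [← entry_coe A, ← entry_coe B, entry_eq_corner, entry_eq_corner,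
    h _ i.2 _ j.2, h _ i.2.le _ j.2, h _ i.2 _ j.2.le, h _ i.2.le _ j.2.le]

end Corner

section Alternating

variable {n : ℕ}

lemma alternating_interval_sum {u : ℕ → ℤ} {p q : ℕ}
    (hu : ∀ j < q, u j = -1 ∨ u j = 0 ∨ u j = 1)
    (halt : ∀ j₁ j₂, j₁ < j₂ → j₂ < q → u j₁ ≠ 0 → u j₂ ≠ 0 →
      (∀ j, j₁ < j → j < j₂ → u j = 0) → u j₂ = -u j₁) (hpq : p ≤ q) :
    ∑ j ∈ Finset.range q, u j - ∑ j ∈ Finset.range p, u j ∈ Set.Icc (-1 : ℤ) 1 := by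
  have key : ∀ m, p ≤ m → m ≤ q →
      ((∀ j, p ≤ j → j < m → u j = 0) ∧
        ∑ j ∈ Finset.range m, u j - ∑ j ∈ Finset.range p, u j = 0) ∨
      ∃ j, j < m ∧ u j ≠ 0 ∧ (∀ i, j < i → i < m → u i = 0) ∧
        (∑ i ∈ Finset.range m, u i - ∑ i ∈ Finset.range p, u i = u j ∨
          ∑ i ∈ Finset.range m, u i - ∑ i ∈ Finset.range p, u i = 0) := by
    intro m hm
    induction m, hm using Nat.le_induction with
    | base =>
      intro _
      exact Or.inl ⟨fun j h₁ h₂ => by omega, by simp⟩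
    | succ m hm ih =>
      intro hmq
      rw [Finset.sum_range_succ]
      by_cases h0 : u m = 0
      · rw [h0, add_zero]
        have hz : ∀ i, ¬ i < m → i < m + 1 → u i = 0 := fun i h₁ h₂ => by
          rw [show i = m by omega, h0]
        rcases ih (by omega) with ⟨hzero, hs⟩ | ⟨j, hj, hne, hzero, hs⟩
        · exact Or.inl ⟨fun i hi him => (em (i < m)).elim (hzero i hi) (hz i · him), hs⟩
        · exact Or.inr ⟨j, by omega, hne,
            fun i hi him => (em (i < m)).elim (hzero i hi) (hz i · him), hs⟩
      · refine Or.inr ⟨m, by omega, h0, fun i _ _ => by omega, ?_⟩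
        rcases ih (by omega) with ⟨_, hs⟩ | ⟨j, hj, hne, hzero, hs⟩
        · left
          linarith
        · have := halt j m hj (by omega) hne h0 hzero
          rcases hs with hs | hs
          · right
            linarith
          · left
            linarith
  rcases key q hpq le_rfl with ⟨_, hs⟩ | ⟨j, hj, _, _, hs⟩
  · simp [hs]
  · rw [Set.mem_Icc]
    have := hu j hj
    omega

lemma Alternating.sum_range_mem {v : Fin n → ℤ} {u : ℕ → ℤ} (huv : ∀ j : Fin n, u j = v j)
    (hv : ∀ j, v j = -1 ∨ v j = 0 ∨ v j = 1) (halt : Alternating v) (hsum : ∑ j, v j = 1)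
    {l : ℕ} (hl : l ≤ n) :
    ∑ j ∈ Finset.range l, u j = 0 ∨ ∑ j ∈ Finset.range l, u j = 1 := by
  have hu : ∀ j < n, u j = -1 ∨ u j = 0 ∨ u j = 1 := fun j hj => by
    simpa only [← huv] using hv ⟨j, hj⟩
  have hualt : ∀ j₁ j₂, j₁ < j₂ → j₂ < n → u j₁ ≠ 0 → u j₂ ≠ 0 →
      (∀ j, j₁ < j → j < j₂ → u j = 0) → u j₂ = -u j₁ := by
    intro j₁ j₂ h₁₂ h₂ hne₁ hne₂ hz
    have := halt ⟨j₁, h₁₂.trans h₂⟩ ⟨j₂, h₂⟩ h₁₂ (by rwa [← huv]) (by rwa [← huv])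
      (fun j h h' => by rw [← huv]; exact hz j h h')
    simpa only [← huv] using this
  have htot : ∑ j ∈ Finset.range n, u j = 1 := by
    rw [← Fin.sum_univ_eq_sum_range, ← hsum]
    exact Finset.sum_congr rfl fun j _ => huv j
  have h₁ := alternating_interval_sum (fun j hj => hu j (hj.trans_le hl))
    (fun j₁ j₂ h h₂ => hualt j₁ j₂ h (h₂.trans_le hl)) (Nat.zero_le l)
  have h₂ := alternating_interval_sum hu hualt hl
  rw [htot, Set.mem_Icc] at h₂
  rw [Finset.sum_range_zero, Set.mem_Icc] at h₁
  omega

lemma alternating_of_sub {v : Fin n → ℤ} {g : ℕ → ℤ} (hv : ∀ j : Fin n, v j = g (j + 1) - g j)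
    (hg : ∀ j ≤ n, g j = 0 ∨ g j = 1) : Alternating v := by
  intro j₁ j₂ h₁₂ h₁ h₂ hz
  have hconst : ∀ m, (j₁ : ℕ) + 1 ≤ m → m ≤ j₂ → g m = g (j₁ + 1) := by
    intro m hm
    induction m, hm using Nat.le_induction with
    | base => exact fun _ => rfl
    | succ m hm ih =>
      intro hmj
      have h := hz ⟨m, by omega⟩ (Fin.lt_def.2 hm) (Fin.lt_def.2 hmj)
      rw [hv] at h
      have := ih (by omega)
      simp only at h
      omega
  have := hconst j₂ h₁₂ le_rfl
  rw [hv] at h₁ h₂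
  rw [hv, hv]
  have := hg j₁ j₁.2.le
  have := hg (j₁ + 1) j₁.2
  have := hg (j₂ + 1) j₂.2
  omega

lemma sum_eq_of_sub {v : Fin n → ℤ} {g : ℕ → ℤ} (hv : ∀ j : Fin n, v j = g (j + 1) - g j) :
    ∑ j, v j = g n - g 0 := by
  rw [← Finset.sum_range_sub, ← Fin.sum_univ_eq_sum_range (fun i => g (i + 1) - g i)]
  exact Finset.sum_congr rfl fun j _ => hv j

end Alternating

section Correspondence

variable {n : ℕ} {A B : Matrix (Fin n) (Fin n) ℤ} {f : ℕ → ℕ → ℤ}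

lemma IsASM.transpose (hA : IsASM A) : IsASM A.transpose :=
  ⟨fun i j => hA.1 j i, hA.2.2.1, hA.2.1, hA.2.2.2.2, hA.2.2.2.1⟩

lemma IsASM.corner_step_left (hA : IsASM A) {k l : ℕ} (hk : k < n) (hl : l ≤ n) :
    corner A (k + 1) l = corner A k l ∨ corner A (k + 1) l = corner A k l + 1 := by
  rw [corner_succ_left]
  have := Alternating.sum_range_mem (u := entry A k) (fun j => entry_coe A ⟨k, hk⟩ j)
    (hA.1 _) (hA.2.2.2.1 _) (hA.2.1 _) hl
  omega

lemma IsASM.corner_top_right (hA : IsASM A) {k : ℕ} (hk : k ≤ n) : corner A k n = k := by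
  induction k with
  | zero => simp
  | succ k ih =>
    rw [corner_succ_left, ih (by omega), ← Fin.sum_univ_eq_sum_range]
    have := hA.2.1 ⟨k, hk⟩
    simp only [← entry_coe] at this
    rw [this]
    push_cast
    rfl

lemma IsASM.isCorner (hA : IsASM A) : IsCorner n (corner A) where
  zero_left l _ := corner_zero_left A l
  zero_right k _ := corner_zero_right A k
  top_left l hl := by
    rw [← corner_transpose]
    exact hA.transpose.corner_top_right hl
  top_right k hk := hA.corner_top_right hk
  step_left k hk l hl := hA.corner_step_left hk hl
  step_right k hk l hl := by
    have := hA.transpose.corner_step_left hl hk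
    simpa only [corner_transpose] using this

lemma IsCorner.isASM (hf : IsCorner n f) : IsASM (ofCorner n f) := by
  have row (i : Fin n) : ∀ j : Fin n, ofCorner n f i j =
      (fun l => f (i + 1) l - f i l) (j + 1) - (fun l => f (i + 1) l - f i l) j := by
    intro j
    simp only [ofCorner, Matrix.of_apply]
    ring
  have col (j : Fin n) : ∀ i : Fin n, ofCorner n f i j =
      (fun k => f k (j + 1) - f k j) (i + 1) - (fun k => f k (j + 1) - f k j) i := by
    intro i
    simp only [ofCorner, Matrix.of_apply]
    ring
  refine ⟨fun i j => ?_, fun i => ?_, fun j => ?_, fun i => ?_, fun j => ?_⟩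
  · have := hf.step_left i i.2 j j.2.le
    have := hf.step_left i i.2 (j + 1) j.2
    simp only [ofCorner, Matrix.of_apply]
    omega
  · rw [sum_eq_of_sub (g := fun l => f (i + 1) l - f i l) (row i)]
    have := hf.top_right i i.2.le
    have := hf.top_right (i + 1) i.2
    have := hf.zero_right i i.2.le
    have := hf.zero_right (i + 1) i.2
    push_cast at *
    linarith
  · rw [sum_eq_of_sub (g := fun k => f k (j + 1) - f k j) (col j)]
    have := hf.top_left j j.2.le
    have := hf.top_left (j + 1) j.2
    have := hf.zero_left j j.2.le
    have := hf.zero_left (j + 1) j.2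
    push_cast at *
    linarith
  · refine alternating_of_sub (g := fun l => f (i + 1) l - f i l) (row i) fun l hl => ?_
    have := hf.step_left i i.2 l hl
    omega
  · refine alternating_of_sub (g := fun k => f k (j + 1) - f k j) (col j) fun k hk => ?_
    have := hf.step_right k hk j j.2
    omega

lemma IsCorner.corner_ofCorner (hf : IsCorner n f) :
    ∀ k ≤ n, ∀ l ≤ n, corner (ofCorner n f) k l = f k l := by
  intro k
  induction k with
  | zero => exact fun _ l hl => by rw [corner_zero_left, hf.zero_left l hl]
  | succ k ihk =>
    intro hk l
    induction l with
    | zero => exact fun _ => by rw [corner_zero_right, hf.zero_right _ hk]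
    | succ l ihl =>
      intro hl
      have h := entry_eq_corner (ofCorner n f) k l
      rw [ihk (by omega) l (by omega), ihk (by omega) (l + 1) hl, ihl (by omega),
        entry_coe (ofCorner n f) ⟨k, hk⟩ ⟨l, hl⟩] at h
      have h' : ofCorner n f ⟨k, hk⟩ ⟨l, hl⟩ =
        f (k + 1) (l + 1) - f k (l + 1) - f (k + 1) l + f k l := rfl
      linarith

lemma IsCorner.transpose (hf : IsCorner n f) : IsCorner n (fun k l => f l k) :=
  ⟨hf.zero_right, hf.zero_left, hf.top_right, hf.top_left,
    fun k hk l hl => hf.step_right l hl k hk, fun k hk l hl => hf.step_left l hl k hk⟩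

lemma IsCorner.left_bounds (hf : IsCorner n f) {k k' l : ℕ} (hkk : k ≤ k') (hk : k' ≤ n)
    (hl : l ≤ n) : f k l ≤ f k' l ∧ f k' l ≤ f k l + ((k' - k : ℕ) : ℤ) := by
  induction k', hkk using Nat.le_induction with
  | base => simp
  | succ m hm ih =>
    have := ih (by omega)
    have := hf.step_left m hk l hl
    omega

lemma IsCorner.right_bounds (hf : IsCorner n f) {k l l' : ℕ} (hll : l ≤ l') (hl : l' ≤ n)
    (hk : k ≤ n) : f k l ≤ f k l' ∧ f k l' ≤ f k l + ((l' - l : ℕ) : ℤ) :=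
  hf.transpose.left_bounds hll hl hk

lemma IsCorner.bounds (hf : IsCorner n f) {k l : ℕ} (hk : k ≤ n) (hl : l ≤ n) :
    0 ≤ f k l ∧ f k l ≤ k ∧ f k l ≤ l ∧ (k : ℤ) + l ≤ f k l + n := by
  have := hf.left_bounds (Nat.zero_le k) hk hl
  have := hf.right_bounds (Nat.zero_le l) hl hk
  have := hf.right_bounds hl le_rfl hk
  have := hf.zero_left l hl
  have := hf.zero_right k hk
  have := hf.top_right k hk
  omega

end Correspondence

/-! ### The extremal corner sum functions -/

/-- The largest corner sum function whose value at `(a, b)` is at most `r`. -/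
def bigrassCorner (a b r k l : ℕ) : ℤ :=
  (min (min k l) (r + (k - a) + (l - b)) : ℕ)

/-- The triples `(a, b, r)` for which `bigrassCorner a b r` is a corner sum function taking
a nonmaximal value `r` at `(a, b)`. -/
structure Admissible (n a b r : ℕ) : Prop where
  left_le : a ≤ n
  right_le : b ≤ n
  lt_left : r < a
  lt_right : r < b
  add_le : a + b ≤ r + n

section Bigrass

variable {n a b r : ℕ} {f : ℕ → ℕ → ℤ} {A B : Matrix (Fin n) (Fin n) ℤ}

lemma Admissible.symm (h : Admissible n a b r) : Admissible n b a r :=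
  ⟨h.right_le, h.left_le, h.lt_right, h.lt_left, by have := h.add_le; omega⟩

lemma bigrassCorner_swap (a b r k l : ℕ) : bigrassCorner a b r k l = bigrassCorner b a r l k := by
  unfold bigrassCorner
  omega

lemma Admissible.isCorner (h : Admissible n a b r) : IsCorner n (bigrassCorner a b r) := by
  obtain ⟨h₁, h₂, h₃, h₄, h₅⟩ := h
  constructor <;> intros <;> unfold bigrassCorner <;> omega

lemma IsCorner.le_bigrassCorner (hf : IsCorner n f) (ha : a ≤ n) (hb : b ≤ n) (hr : f a b ≤ r)
    {k l : ℕ} (hk : k ≤ n) (hl : l ≤ n) : f k l ≤ bigrassCorner a b r k l := by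
  have := hf.bounds hk hl
  have := (hf.left_bounds (le_max_left k a) (max_le hk ha) hl).1
  have := (hf.right_bounds (le_max_left l b) (max_le hl hb) (max_le hk ha)).1
  have := (hf.left_bounds (le_max_right k a) (max_le hk ha) (max_le hl hb)).2
  have := (hf.right_bounds (le_max_right l b) (max_le hl hb) ha).2
  unfold bigrassCorner
  omega

lemma Admissible.isCorner_update (h : Admissible n a b r) :
    IsCorner n (fun k l => bigrassCorner a b r k l + if k = a ∧ l = b then 1 else 0) := by
  obtain ⟨h₁, h₂, h₃, h₄, h₅⟩ := h
  constructor <;> intros <;> unfold bigrassCorner <;> split_ifs <;> omega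

/-- Matrices with extremal corner sums are not joins of other elements. -/
lemma Admissible.not_isLUB (h : Admissible n a b r)
    (hAJ : ∀ k ≤ n, ∀ l ≤ n, corner A k l = bigrassCorner a b r k l)
    {S : Set (Matrix (Fin n) (Fin n) ℤ)} (hS : ∀ B ∈ S, IsASM B) (hAS : A ∉ S)
    (hle : ∀ B ∈ S, asmLe B A) :
    ∃ C, IsASM C ∧ (∀ B ∈ S, asmLe B C) ∧ ¬ asmLe A C := by
  have hJ : bigrassCorner a b r a b = r := by
    have := h.lt_left
    have := h.lt_right
    unfold bigrassCorner
    omega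
  refine ⟨_, h.isCorner_update.isASM, fun B hB => ?_, fun hAC => ?_⟩
  · have hle' := asmLe_iff_corner.1 (hle B hB)
    have hlt : (r : ℤ) < corner B a b := by
      by_contra! hr
      have hBA : B = A := eq_of_corner_eq fun k hk l hl =>
        le_antisymm
          ((hAJ k hk l hl).symm ▸ (hS B hB).isCorner.le_bigrassCorner h.left_le h.right_le hr hk hl)
          (hle' k hk l hl)
      exact hAS (hBA ▸ hB)
    rw [asmLe_iff_corner]
    intro k hk l hl
    rw [h.isCorner_update.corner_ofCorner k hk l hl]
    have := hle' k hk l hl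
    rw [hAJ k hk l hl] at this
    split_ifs with hkl
    · obtain ⟨rfl, rfl⟩ := hkl
      omega
    · omega
  · have := asmLe_iff_corner.1 hAC a h.left_le b h.right_le
    rw [h.isCorner_update.corner_ofCorner a h.left_le b h.right_le,
      hAJ a h.left_le b h.right_le] at this
    simp at this

/-- Every join-irreducible alternating sign matrix has extremal corner sums. -/
lemma IsASM.exists_admissible (hA : IsASM A)
    (hirr : ∀ S : Set (Matrix (Fin n) (Fin n) ℤ), (∀ B ∈ S, IsASM B) → A ∉ S →
      (∀ B ∈ S, asmLe B A) →
      ∃ C, IsASM C ∧ (∀ B ∈ S, asmLe B C) ∧ ¬ asmLe A C) :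
    ∃ a b r, Admissible n a b r ∧
      ∀ k ≤ n, ∀ l ≤ n, corner A k l = bigrassCorner a b r k l := by
  let S : Set (Matrix (Fin n) (Fin n) ℤ) := {B | ∃ a b r, Admissible n a b r ∧
    corner A a b = r ∧ B = ofCorner n (bigrassCorner a b r)}
  by_cases hAS : A ∈ S
  · obtain ⟨a, b, r, h, _, hAJ⟩ := hAS
    refine ⟨a, b, r, h, fun k hk l hl => ?_⟩
    rw [hAJ, h.isCorner.corner_ofCorner k hk l hl]
  · obtain ⟨C, hC, hSC, hAC⟩ := hirr S
      (by rintro _ ⟨a, b, r, h, _, rfl⟩; exact h.isCorner.isASM) hAS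
      (by
        rintro _ ⟨a, b, r, h, hr, rfl⟩
        rw [asmLe_iff_corner]
        intro k hk l hl
        rw [h.isCorner.corner_ofCorner k hk l hl]
        exact hA.isCorner.le_bigrassCorner h.left_le h.right_le hr.le hk hl)
    refine absurd (asmLe_iff_corner.2 fun a ha b hb => ?_) hAC
    have hAb := hA.isCorner.bounds ha hb
    have hCb := hC.isCorner.bounds ha hb
    obtain ⟨r, hr⟩ := Int.eq_ofNat_of_zero_le hAb.1
    by_cases hlt : r < a ∧ r < b
    · have h : Admissible n a b r := ⟨ha, hb, hlt.1, hlt.2, by omega⟩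
      have := asmLe_iff_corner.1 (hSC _ ⟨a, b, r, h, hr, rfl⟩) a ha b hb
      rw [h.isCorner.corner_ofCorner a ha b hb] at this
      unfold bigrassCorner at this
      omega
    · omega

/-! ### Permutation matrices and descents -/

lemma eq_of_sum_eq_one {v : Fin n → ℤ} (hv : ∀ i, 0 ≤ v i) (hsum : ∑ i, v i = 1) {i j : Fin n}
    (hi : v i = 1) (hj : v j = 1) : i = j := by
  by_contra hne
  have := Finset.sum_le_sum_of_subset_of_nonneg (f := v) (Finset.subset_univ {i, j})
    (fun k _ _ => hv k)
  rw [Finset.sum_pair hne] at this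
  omega

lemma IsASM.exists_permMat (hA : IsASM A) (hnn : ∀ i j, 0 ≤ A i j) :
    ∃ w : Equiv.Perm (Fin n), A = permMat w := by
  have hex : ∀ j, ∃ i, A i j = 1 := by
    intro j
    by_contra! hne
    have := hA.2.2.1 j
    rw [Finset.sum_eq_zero] at this
    · omega
    · intro i _
      have := hA.1 i j
      have := hnn i j
      have := hne i
      omega
  choose w hw using hex
  have hinj : Function.Injective w := fun j₁ j₂ h =>
    eq_of_sum_eq_one (hnn (w j₁)) (hA.2.1 _) (hw j₁) (h ▸ hw j₂)
  refine ⟨Equiv.ofBijective w (Finite.injective_iff_bijective.1 hinj), ?_⟩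
  ext i j
  simp only [permMat, Matrix.of_apply, Equiv.ofBijective_apply]
  split_ifs with hij
  · rw [← hij, hw]
  · have := hA.1 i j
    have := hnn i j
    have : A i j ≠ 1 := fun h =>
      hij (eq_of_sum_eq_one (fun i => hnn i j) (hA.2.2.1 j) (hw j) h)
    omega

lemma permMat_inv (w : Equiv.Perm (Fin n)) : permMat w⁻¹ = (permMat w).transpose := by
  ext i j
  simp only [permMat, Matrix.of_apply, Matrix.transpose_apply, Equiv.Perm.inv_eq_iff_eq,
    eq_comm (a := j)]

lemma corner_permMat_inv (w : Equiv.Perm (Fin n)) (k l : ℕ) :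
    corner (permMat w⁻¹) k l = corner (permMat w) l k := by
  rw [permMat_inv, corner_transpose]

lemma corner_permMat_succ (w : Equiv.Perm (Fin n)) {k l : ℕ} (hk : k ≤ n) (hl : l < n) :
    corner (permMat w) k (l + 1) =
      corner (permMat w) k l + if (w ⟨l, hl⟩ : ℕ) < k then 1 else 0 := by
  rw [corner_succ_right]
  congr 1
  have : ∀ i ∈ Finset.range k, entry (permMat w) i l =
      if (w ⟨l, hl⟩ : ℕ) = i then 1 else 0 := by
    intro i hi
    have hi' : i < n := (Finset.mem_range.1 hi).trans_le hk
    rw [entry_coe (permMat w) ⟨i, hi'⟩ ⟨l, hl⟩]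
    simp only [permMat, Matrix.of_apply, Fin.ext_iff]
  rw [Finset.sum_congr rfl this, Finset.sum_ite_eq]
  simp only [Finset.mem_range]

lemma mem_descents {w : Equiv.Perm (Fin n)} {i : ℕ} (hi : i + 1 < n) :
    i ∈ descents w ↔ w ⟨i + 1, hi⟩ < w ⟨i, Nat.lt_of_succ_lt hi⟩ := by
  simp only [descents, Finset.mem_filter, Finset.mem_range]
  exact ⟨fun h => h.2 hi, fun h => ⟨by omega, fun _ => h⟩⟩

lemma lt_of_mem_descents {w : Equiv.Perm (Fin n)} {i : ℕ} (hi : i ∈ descents w) : i + 1 < n := by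
  simp only [descents, Finset.mem_filter, Finset.mem_range] at hi
  omega

lemma mem_descents_iff_corner {w : Equiv.Perm (Fin n)} {i : ℕ} (hi : i + 1 < n) :
    i ∈ descents w ↔ ∃ k ≤ n, 2 * corner (permMat w) k (i + 1) <
      corner (permMat w) k i + corner (permMat w) k (i + 2) := by
  rw [mem_descents hi]
  constructor
  · intro h
    have hk : (w ⟨i + 1, hi⟩ : ℕ) + 1 ≤ n := (w _).2
    refine ⟨w ⟨i + 1, hi⟩ + 1, hk, ?_⟩
    rw [corner_permMat_succ w hk hi, corner_permMat_succ w hk (Nat.lt_of_succ_lt hi),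
      if_pos (Nat.lt_succ_self _), if_neg (by rw [Fin.lt_def] at h; omega)]
    omega
  · rintro ⟨k, hk, h⟩
    rw [corner_permMat_succ w hk hi, corner_permMat_succ w hk (Nat.lt_of_succ_lt hi)] at h
    rw [Fin.lt_def]
    split_ifs at h <;> omega

lemma Admissible.card_descents (h : Admissible n a b r) {w : Equiv.Perm (Fin n)}
    (hw : ∀ k ≤ n, ∀ l ≤ n, corner (permMat w) k l = bigrassCorner a b r k l) :
    (descents w).card = 1 := by
  obtain ⟨h₁, h₂, h₃, h₄, h₅⟩ := h
  rw [Finset.card_eq_one]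
  refine ⟨b - 1, ?_⟩
  ext i
  rw [Finset.mem_singleton]
  constructor
  · intro hi
    have hin := lt_of_mem_descents hi
    obtain ⟨k, hk, hlt⟩ := (mem_descents_iff_corner hin).1 hi
    rw [hw k hk _ (by omega), hw k hk _ (by omega), hw k hk _ (by omega)] at hlt
    unfold bigrassCorner at hlt
    omega
  · rintro rfl
    rw [mem_descents_iff_corner (by omega)]
    refine ⟨a, h₁, ?_⟩
    rw [hw a h₁ _ (by omega), hw a h₁ _ (by omega), hw a h₁ _ (by omega)]
    unfold bigrassCorner
    omega

lemma Admissible.exists_bigrassmannian (h : Admissible n a b r) (hA : IsASM A)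
    (hAJ : ∀ k ≤ n, ∀ l ≤ n, corner A k l = bigrassCorner a b r k l) :
    ∃ w : Equiv.Perm (Fin n), A = permMat w ∧ Bigrassmannian w := by
  obtain ⟨w, rfl⟩ := hA.exists_permMat fun i j => by
    rw [← entry_coe A, entry_eq_corner, hAJ _ i.2 _ j.2, hAJ _ i.2.le _ j.2,
      hAJ _ i.2 _ j.2.le, hAJ _ i.2.le _ j.2.le]
    obtain ⟨h₁, h₂, h₃, h₄, h₅⟩ := h
    unfold bigrassCorner
    omega
  refine ⟨w, rfl, h.card_descents hAJ, h.symm.card_descents fun k hk l hl => ?_⟩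
  rw [corner_permMat_inv, hAJ l hl k hk, bigrassCorner_swap]

lemma eq_min_of_concave {g : ℕ → ℤ} {p q : ℕ}
    (hstep : ∀ x, p ≤ x → x < q → g (x + 1) = g x ∨ g (x + 1) = g x + 1)
    (hconc : ∀ x, p ≤ x → x + 1 < q → g x + g (x + 2) ≤ 2 * g (x + 1)) {x : ℕ}
    (hpx : p ≤ x) (hxq : x ≤ q) : g x = min (g p + ((x - p : ℕ) : ℤ)) (g q) := by
  have hmono : ∀ y z, p ≤ y → y ≤ z → z ≤ q → g y ≤ g z := by
    intro y z hy hyz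
    induction z, hyz using Nat.le_induction with
    | base => exact fun _ => le_rfl
    | succ m hm ih =>
      intro hmq
      have := ih (by omega)
      have := hstep m (by omega) hmq
      omega
  have hflat : ∀ y, p ≤ y → y < q → g (y + 1) = g y → g q = g y := by
    intro y hy hyq hflat
    have : ∀ z, y + 1 ≤ z → z ≤ q → g z = g y ∧ g (z - 1) = g y := by
      intro z hz
      induction z, hz using Nat.le_induction with
      | base => exact fun _ => ⟨hflat, rfl⟩
      | succ m hm ih =>
        intro hmq
        obtain ⟨h₁, h₂⟩ := ih (by omega)
        have h₃ := hconc (m - 1) (by omega) (by omega)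
        rw [show m - 1 + 2 = m + 1 by omega, show m - 1 + 1 = m by omega] at h₃
        have := hstep m (by omega) (by omega)
        simp only [Nat.add_sub_cancel]
        omega
    exact (this q hyq le_rfl).1
  induction x, hpx using Nat.le_induction with
  | base =>
    have := hmono p q le_rfl hxq le_rfl
    simp [this]
  | succ m hm ih =>
    have := ih (by omega)
    have := hstep m hm hxq
    have := hflat m hm hxq
    have := hmono (m + 1) q (by omega) hxq le_rfl
    omega

lemma Bigrassmannian.exists_admissible {w : Equiv.Perm (Fin n)} (hw : Bigrassmannian w)
    (hA : IsASM (permMat w)) : ∃ a b r, Admissible n a b r ∧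
      ∀ k ≤ n, ∀ l ≤ n, corner (permMat w) k l = bigrassCorner a b r k l := by
  obtain ⟨e, he⟩ := Finset.card_eq_one.1 hw.1
  obtain ⟨d, hd⟩ := Finset.card_eq_one.1 hw.2
  have hc := hA.isCorner
  have hen : e + 1 < n := lt_of_mem_descents (he ▸ Finset.mem_singleton_self e)
  have hdn : d + 1 < n := lt_of_mem_descents (hd ▸ Finset.mem_singleton_self d)
  have hright : ∀ k ≤ n, ∀ x, x + 1 < n → x ≠ e → corner (permMat w) k x +
      corner (permMat w) k (x + 2) ≤ 2 * corner (permMat w) k (x + 1) := by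
    intro k hk x hx hxe
    by_contra! hlt
    have := (mem_descents_iff_corner hx).2 ⟨k, hk, hlt⟩
    rw [he, Finset.mem_singleton] at this
    exact hxe this
  have hleft : ∀ l ≤ n, ∀ x, x + 1 < n → x ≠ d → corner (permMat w) x l +
      corner (permMat w) (x + 2) l ≤ 2 * corner (permMat w) (x + 1) l := by
    intro l hl x hx hxd
    by_contra! hlt
    have := (mem_descents_iff_corner (w := w⁻¹) hx).2
      ⟨l, hl, by simpa only [corner_permMat_inv] using hlt⟩
    rw [hd, Finset.mem_singleton] at this
    exact hxd this
  obtain ⟨r, hr⟩ := Int.eq_ofNat_of_zero_le (hc.bounds hdn.le hen.le).1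
  have hab := hc.bounds hdn.le hen.le
  have hrow : ∀ l ≤ n, corner (permMat w) (d + 1) l = bigrassCorner (d + 1) (e + 1) r (d + 1) l := by
    intro l hl
    have h0 := hc.zero_right (d + 1) hdn.le
    have hn := hc.top_right (d + 1) hdn.le
    unfold bigrassCorner
    rcases le_total l (e + 1) with h | h
    · have := eq_min_of_concave (g := corner (permMat w) (d + 1)) (p := 0) (q := e + 1)
        (fun x _ hx => hc.step_right _ hdn.le x (by omega))
        (fun x _ hx => hright _ hdn.le x (by omega) (by omega)) (Nat.zero_le l) h
      omega
    · have := eq_min_of_concave (g := corner (permMat w) (d + 1)) (p := e + 1) (q := n)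
        (fun x _ hx => hc.step_right _ hdn.le x (by omega))
        (fun x _ hx => hright _ hdn.le x (by omega) (by omega)) h hl
      omega
  have hall : ∀ k ≤ n, ∀ l ≤ n,
      corner (permMat w) k l = bigrassCorner (d + 1) (e + 1) r k l := by
    intro k hk l hl
    have h0 := hc.zero_left l hl
    have hn := hc.top_left l hl
    have hmid := hrow l hl
    unfold bigrassCorner at hmid ⊢
    rcases le_total k (d + 1) with h | h
    · have := eq_min_of_concave (g := fun k => corner (permMat w) k l) (p := 0) (q := d + 1)
        (fun x _ hx => hc.step_left x (by omega) l hl)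
        (fun x _ hx => hleft _ hl x (by omega) (by omega)) (Nat.zero_le k) h
      omega
    · have := eq_min_of_concave (g := fun k => corner (permMat w) k l) (p := d + 1) (q := n)
        (fun x _ hx => hc.step_left x (by omega) l hl)
        (fun x _ hx => hleft _ hl x (by omega) (by omega)) h hk
      omega
  obtain ⟨k, hk, hlt⟩ := (mem_descents_iff_corner hen).1 (he ▸ Finset.mem_singleton_self e)
  rw [hall k hk _ (by omega), hall k hk _ (by omega), hall k hk _ (by omega)] at hlt
  unfold bigrassCorner at hlt
  exact ⟨d + 1, e + 1, r, ⟨hdn.le, hen.le, by omega, by omega, by omega⟩, hall⟩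

end Bigrass

end ASMPaper

open ASMPaper in
/-- For `n ≥ 2`, the join-irreducible elements of the lattice `ASM_n` (the alternating
sign matrices that are not the least upper bound of any set of alternating sign matrices
not containing them) are exactly the permutation matrices of bigrassmannian
permutations. -/
theorem asm_joinIrreducible_iff_bigrassmannian (n : ℕ) (hn : 2 ≤ n)
    (A : Matrix (Fin n) (Fin n) ℤ) (hA : IsASM A) :
    (¬ ∃ S : Set (Matrix (Fin n) (Fin n) ℤ),
        (∀ B ∈ S, IsASM B) ∧ A ∉ S ∧
        (∀ B ∈ S, asmLe B A) ∧
        (∀ C : Matrix (Fin n) (Fin n) ℤ, IsASM C → (∀ B ∈ S, asmLe B C) → asmLe A C)) ↔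
    (∃ w : Equiv.Perm (Fin n), A = permMat w ∧ Bigrassmannian w) := by
  constructor
  · intro h
    push Not at h
    obtain ⟨a, b, r, hadm, hAJ⟩ := hA.exists_admissible h
    exact hadm.exists_bigrassmannian hA hAJ
  · rintro ⟨w, rfl, hw⟩ ⟨S, hS, hAS, hle, hlub⟩
    obtain ⟨a, b, r, hadm, hAJ⟩ := hw.exists_admissible hA
    obtain ⟨C, hC, hSC, hAC⟩ := hadm.not_isLUB hAJ hS hAS hle
    exact hAC (hlub C hC hSC)
end
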